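/- Define a Gallai coloring of the complete graph K_n as an edge coloring with no triangle receiving three distinct colors. There is no Gallai coloring of K_6 with exactly 4 colors in which the color classes have sizes 4, 4, 4, 3. -/

import Mathlib

/-- A Gallai coloring of `K_n`: an edge coloring with no triangle receiving
three pairwise distinct colors. -/
def IsGallaiColoring {n : ℕ} {C : Type*} (c : Sym2 (Fin n) → C) : Prop :=
  ∀ x y z : Fin n, x ≠ y → y ≠ z → x ≠ z →
    c s(x, y) = c s(y, z) ∨ c s(y, z) = c s(x, z) ∨ c s(x, y) = c s(x, z)

/-- The graph of edges of color `i`. -/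
def colorGraph {n : ℕ} {C : Type*} (c : Sym2 (Fin n) → C) (i : C) : SimpleGraph (Fin n) where
  Adj x y := x ≠ y ∧ c s(x, y) = i
  symm := ⟨fun x y h => ⟨h.1.symm, by rw [Sym2.eq_swap]; exact h.2⟩⟩
  loopless := ⟨fun x h => h.1 rfl⟩

theorem exists_connected_color {C : Type*} [Nonempty C] (n : ℕ) :
    ∀ c : Sym2 (Fin (n + 1)) → C, IsGallaiColoring c → ∃ i, (colorGraph c i).Connected := by
  induction n with
  | zero =>
    intro c _
    refine ⟨Classical.arbitrary C, ?_⟩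
    have : Nonempty (Fin (0 + 1)) := ⟨0⟩
    refine ⟨fun x y => ?_⟩
    rw [Subsingleton.elim (α := Fin 1) x y]
  | succ n ih =>
    intro c hc
    have hs : ∀ {x y : Fin (n + 1)}, x ≠ y → x.succ ≠ y.succ :=
      fun h h' => h (Fin.succ_injective _ h')
    obtain ⟨i, hi⟩ := ih (fun e => c (e.map Fin.succ)) (by
      intro x y z h1 h2 h3
      exact hc x.succ y.succ z.succ (hs h1) (hs h2) (hs h3))
    let f : colorGraph (fun e => c (e.map Fin.succ)) i →g colorGraph c i :=
      ⟨Fin.succ, fun {a b} h => ⟨hs h.1, h.2⟩⟩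
    have key : ∀ j, (∀ x : Fin (n + 1), (colorGraph c j).Reachable 0 x.succ) →
        (colorGraph c j).Connected := by
      intro j hj
      have h0 : ∀ x, (colorGraph c j).Reachable 0 x := by
        intro x
        refine Fin.cases ?_ ?_ x
        · exact SimpleGraph.Reachable.refl _
        · exact hj
      exact ⟨fun x y => (h0 x).symm.trans (h0 y)⟩
    by_cases hex : ∃ x : Fin (n + 1), c s(0, x.succ) = i
    · obtain ⟨x, hx⟩ := hex
      refine ⟨i, key i fun y => ?_⟩
      have h1 : (colorGraph c i).Adj 0 x.succ := ⟨(Fin.succ_ne_zero x).symm, hx⟩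
      exact h1.reachable.trans ((hi.preconnected x y).map f)
    · push Not at hex
      refine ⟨c s(0, (0 : Fin (n + 1)).succ), key _ fun y => ?_⟩
      have hall : ∀ x y : Fin (n + 1), c s(0, x.succ) = c s(0, y.succ) := by
        intro x y
        obtain ⟨w⟩ := hi.preconnected x y
        induction w with
        | nil => rfl
        | cons h _ ih2 =>
          rename_i u v w _
          refine Eq.trans ?_ ih2
          have h2 : c s(u.succ, v.succ) = i := h.2
          rcases hc 0 u.succ v.succ (Fin.succ_ne_zero _).symm (hs h.1)
            (Fin.succ_ne_zero _).symm with h3 | h3 | h3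
          · exact absurd (h3.trans h2) (hex u)
          · exact absurd (h3.symm.trans h2) (hex v)
          · exact h3
      have h1 : (colorGraph c (c s(0, (0 : Fin (n + 1)).succ))).Adj 0 y.succ :=
        ⟨(Fin.succ_ne_zero y).symm, hall _ _⟩
      exact h1.reachable

theorem stmt_12 :
    ¬ ∃ c : Sym2 (Fin 6) → Fin 4, IsGallaiColoring c ∧
      Multiset.map
        (fun i => (Finset.univ.filter
          (fun e : Sym2 (Fin 6) => ¬ e.IsDiag ∧ c e = i)).card)
        (Finset.univ : Finset (Fin 4)).val = {4, 4, 4, 3} := by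
  rintro ⟨c, hc, hm⟩
  obtain ⟨i, hi⟩ := exists_connected_color 5 c hc
  have h1 := hi.card_vert_le_card_edgeSet_add_one
  have h2 : (colorGraph c i).edgeSet =
      ↑(Finset.univ.filter (fun e : Sym2 (Fin 6) => ¬ e.IsDiag ∧ c e = i)) := by
    ext e
    induction e with
    | _ x y => simp [colorGraph]
  rw [h2] at h1
  have h3 : (Finset.univ.filter (fun e : Sym2 (Fin 6) => ¬ e.IsDiag ∧ c e = i)).card ∈
      ({4, 4, 4, 3} : Multiset ℕ) := by
    rw [← hm]
    exact Multiset.mem_map_of_mem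
      (fun i => (Finset.univ.filter (fun e : Sym2 (Fin 6) => ¬ e.IsDiag ∧ c e = i)).card)
      (Finset.mem_univ i)
  rw [Nat.card_coe_set_eq, Set.ncard_coe_finset, Nat.card_fin] at h1
  simp only [Multiset.insert_eq_cons, Multiset.mem_cons, Multiset.mem_singleton] at h3
  omega
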